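/- arXiv:1503.04285 — 2 statements merged into one kernel-verified Lean document; each statement's English description precedes it below -/
import Mathlib

section
/- Fix q ∈ (0,1) and x, λ ∈ [0, 1/(1−q)). The function ν ↦ E_{ν+1}(λx; q²) / E_ν(λx; q²) is increasing on (0,∞): for all 0 < μ ≤ ν, E_{μ+1}(λx; q²)/E_μ(λx; q²) ≤ E_{ν+1}(λx; q²)/E_ν(λx; q²). -/
open Real

/-- The `q`-gamma function with base `p ∈ (0,1)`:
`Γ_p(x) = (1-p)^{1-x} ∏_{n=0}^∞ (1-p^{n+1})/(1-p^{n+x})`. -/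
noncomputable def qGamma (p x : ℝ) : ℝ :=
  (1 - p) ^ (1 - x) * ∏' n : ℕ, (1 - p ^ (n + 1)) / (1 - p ^ ((n : ℝ) + x))

/-- `b_k(ν; q²)` from the series expansion of the `q`-Dunkl kernel:
`b_{2k}(ν;q²) = (1+q)^k Γ_{q²}(k+1) Γ_{q²}(ν+k+1)/Γ_{q²}(ν+1)` and
`b_{2k+1}(ν;q²) = (1+q)^{2k+1} Γ_{q²}(k+1) Γ_{q²}(ν+k+2)/Γ_{q²}(ν+1)`. -/
noncomputable def qDunklB (q : ℝ) (n : ℕ) (ν : ℝ) : ℝ :=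
  if Even n then
    (1 + q) ^ (n / 2) * qGamma (q ^ 2) ((n / 2 : ℕ) + 1) *
      qGamma (q ^ 2) (ν + (n / 2 : ℕ) + 1) / qGamma (q ^ 2) (ν + 1)
  else
    (1 + q) ^ n * qGamma (q ^ 2) ((n / 2 : ℕ) + 1) *
      qGamma (q ^ 2) (ν + (n / 2 : ℕ) + 2) / qGamma (q ^ 2) (ν + 1)

/-- The `q`-Dunkl kernel `E_ν(z; q²) = Σ_{k=0}^∞ z^k / b_k(ν; q²)`. -/
noncomputable def qDunklE (q ν z : ℝ) : ℝ :=
  ∑' k : ℕ, z ^ k / qDunklB q k ν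

/-- The infinite `q`-shifted factorial `(a; p)_∞ = ∏_{k=0}^∞ (1 - a p^k)`. -/
noncomputable def qPochInf (a p : ℝ) : ℝ :=
  ∏' k : ℕ, (1 - a * p ^ k)

/-- The weight `W_ν(x; q²) = (x²q²; q²)_∞ / (x²q^{2ν+1}; q²)_∞`. -/
noncomputable def qW (q ν x : ℝ) : ℝ :=
  qPochInf (x ^ 2 * q ^ 2) (q ^ 2) / qPochInf (x ^ 2 * q ^ (2 * ν + 1)) (q ^ 2)

/-- The `q`-exponential `E(q, z) = ∏_{k=0}^∞ (1 + z q^k)`. -/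
noncomputable def qExpBig (q z : ℝ) : ℝ :=
  ∏' k : ℕ, (1 + z * q ^ k)

/-- The `q`-Jackson integral over `[-1,1]`:
`∫_{-1}^1 f(t) d_q t = (1-q) Σ_{n=0}^∞ q^n (f(q^n) + f(-q^n))`. -/
noncomputable def jacksonSym (q : ℝ) (f : ℝ → ℝ) : ℝ :=
  (1 - q) * ∑' n : ℕ, q ^ n * (f (q ^ n) + f (-(q ^ n)))

/-- The normalized `q`-Dunkl kernel
`Ẽ_ν(x; q²) = ∫_{-1}^1 W_ν(t;q²)(1+t) E(q,(1-q)tx) d_q t`. -/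
noncomputable def qDunklEt (q ν x : ℝ) : ℝ :=
  jacksonSym q (fun t => qW q ν t * (1 + t) * qExpBig q ((1 - q) * t * x))


lemma aux_summ (p y : ℝ) (h0 : 0 < p) (h1 : p < 1) :
    Summable (fun n : ℕ => Real.log (1 - p ^ ((n : ℝ) + y))) := by
  have h : Summable (fun n : ℕ => -(p ^ ((n : ℝ) + y))) := by
    have := ((summable_geometric_of_lt_one h0.le h1).mul_right (p ^ y)).neg
    refine this.congr fun n => ?_
    rw [Real.rpow_add h0, Real.rpow_natCast]
  have := Real.summable_log_one_add_of_summable h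
  exact this.congr fun n => by rw [sub_eq_add_neg]

lemma aux_pos (p y : ℝ) (h0 : 0 < p) (h1 : p < 1) (hy : 0 < y) : 0 < 1 - p ^ y := by
  have := Real.rpow_lt_one h0.le h1 hy
  linarith

lemma qGamma_eq (p y : ℝ) (h0 : 0 < p) (h1 : p < 1) (hy : 0 < y) :
    qGamma p y = (1 - p) ^ (1 - y) * Real.exp ((∑' n : ℕ, Real.log (1 - p ^ ((n : ℝ) + 1))) -
      ∑' n : ℕ, Real.log (1 - p ^ ((n : ℝ) + y))) := by
  unfold qGamma
  congr 1
  have hp1 : ∀ n : ℕ, 0 < 1 - p ^ ((n : ℝ) + 1) := fun n => aux_pos p _ h0 h1 (by positivity)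
  have hpy : ∀ n : ℕ, 0 < 1 - p ^ ((n : ℝ) + y) := fun n => aux_pos p _ h0 h1 (by positivity)
  have e : ∀ n : ℕ, (1 - p ^ (n + 1)) / (1 - p ^ ((n : ℝ) + y)) =
      (1 - p ^ ((n : ℝ) + 1)) / (1 - p ^ ((n : ℝ) + y)) := fun n => by
    rw [← Nat.cast_succ, Real.rpow_natCast]
  simp_rw [e]
  have hl : ∀ n : ℕ, Real.log ((1 - p ^ ((n : ℝ) + 1)) / (1 - p ^ ((n : ℝ) + y))) =
     Real.log (1 - p ^ ((n : ℝ) + 1)) - Real.log (1 - p ^ ((n : ℝ) + y)) := fun n =>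
     Real.log_div (hp1 n).ne' (hpy n).ne'
  have s1 := aux_summ p 1 h0 h1
  have s2 := aux_summ p y h0 h1
  rw [← Real.rexp_tsum_eq_tprod (fun n => div_pos (hp1 n) (hpy n))
    ((s1.sub s2).congr fun n => (hl n).symm)]
  simp_rw [hl]
  rw [s1.tsum_sub s2]

lemma qGamma_pos (p y : ℝ) (h0 : 0 < p) (h1 : p < 1) (hy : 0 < y) : 0 < qGamma p y := by
  rw [qGamma_eq p y h0 h1 hy]
  have : 0 < 1 - p := by linarith
  positivity

lemma qGamma_succ (p y : ℝ) (h0 : 0 < p) (h1 : p < 1) (hy : 0 < y) :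
    qGamma p (y + 1) = (1 - p ^ y) / (1 - p) * qGamma p y := by
  rw [qGamma_eq p y h0 h1 hy, qGamma_eq p (y + 1) h0 h1 (by linarith)]
  have hp : 0 < 1 - p := by linarith
  have h := (aux_summ p y h0 h1).tsum_eq_zero_add
  have e : ∀ n : ℕ, ((n + 1 : ℕ) : ℝ) + y = (n : ℝ) + (y + 1) := fun n => by push_cast; ring
  simp_rw [e] at h
  rw [h]
  have e2 : (1 - p) ^ (1 - (y + 1)) = (1 - p) ^ (1 - y) / (1 - p) := by
    rw [show 1 - (y + 1) = (1 - y) - 1 by ring, Real.rpow_sub_one hp.ne']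
  rw [e2]
  have hy' := aux_pos p y h0 h1 hy
  simp only [Nat.cast_zero, zero_add]
  rw [sub_add_eq_sub_sub, sub_right_comm, Real.exp_sub _ (Real.log _), Real.exp_log hy']
  field_simp

/-- ratio of gammas -/
noncomputable def gg (p : ℝ) (k : ℕ) (ν : ℝ) : ℝ := qGamma p (ν + k + 1) / qGamma p (ν + 1)

lemma gg_pos (p ν : ℝ) (k : ℕ) (h0 : 0 < p) (h1 : p < 1) (hν : 0 < ν) : 0 < gg p k ν :=
  div_pos (qGamma_pos p _ h0 h1 (by positivity)) (qGamma_pos p _ h0 h1 (by positivity))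

lemma gg_zero (p ν : ℝ) (h0 : 0 < p) (h1 : p < 1) (hν : 0 < ν) : gg p 0 ν = 1 := by
  unfold gg
  simp only [Nat.cast_zero, add_zero]
  exact div_self (qGamma_pos p _ h0 h1 (by positivity)).ne'

lemma gg_succ (p ν : ℝ) (k : ℕ) (h0 : 0 < p) (h1 : p < 1) (hν : 0 < ν) :
    gg p (k + 1) ν = (1 - p ^ (ν + k + 1)) / (1 - p) * gg p k ν := by
  unfold gg
  rw [Nat.cast_succ, ← add_assoc, qGamma_succ p (ν + k + 1) h0 h1 (by positivity)]
  ring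

lemma gg_shift (p ν : ℝ) (k : ℕ) (h0 : 0 < p) (h1 : p < 1) (hν : 0 < ν) :
    gg p k (ν + 1) = gg p k ν / ((1 - p ^ (ν + 1)) / (1 - p ^ (ν + k + 1))) := by
  unfold gg
  have a1 := aux_pos p (ν + 1) h0 h1 (by positivity)
  have a2 := aux_pos p (ν + k + 1) h0 h1 (by positivity)
  have a3 := qGamma_pos p (ν + 1) h0 h1 (by positivity)
  have hp : 0 < 1 - p := by linarith
  rw [show ν + 1 + k + 1 = (ν + k + 1) + 1 by ring, qGamma_succ p (ν + k + 1) h0 h1 (by positivity),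
    qGamma_succ p (ν + 1) h0 h1 (by positivity)]
  field_simp

lemma gg_ratio_anti (p μ ν : ℝ) (h0 : 0 < p) (h1 : p < 1) (hμ : 0 < μ) (h : μ ≤ ν) :
    Antitone (fun k => gg p k μ / gg p k ν) := by
  refine antitone_nat_of_succ_le fun k => ?_
  have hν : 0 < ν := by linarith
  rw [gg_succ p μ k h0 h1 hμ, gg_succ p ν k h0 h1 hν]
  have b1 := gg_pos p μ k h0 h1 hμ
  have b2 := gg_pos p ν k h0 h1 hν
  have a1 := aux_pos p (μ + k + 1) h0 h1 (by positivity)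
  have a2 := aux_pos p (ν + k + 1) h0 h1 (by positivity)
  have hp : 0 < 1 - p := by linarith
  have : p ^ (ν + k + 1) ≤ p ^ (μ + k + 1) :=
    Real.rpow_le_rpow_of_exponent_ge h0 h1.le (by linarith)
  have e : (1 - p ^ (μ + k + 1)) / (1 - p) * gg p k μ / ((1 - p ^ (ν + k + 1)) / (1 - p) * gg p k ν)
    = ((1 - p ^ (μ + k + 1)) / (1 - p ^ (ν + k + 1))) * (gg p k μ / gg p k ν) := by
    field_simp
  rw [e]
  refine mul_le_of_le_one_left (by positivity) ?_
  rw [div_le_one a2]; linarith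

lemma f_mono (p μ ν : ℝ) (k : ℕ) (h0 : 0 < p) (h1 : p < 1) (hμ : 0 < μ) (h : μ ≤ ν) :
    (1 - p ^ (μ + 1)) / (1 - p ^ (μ + k + 1)) ≤ (1 - p ^ (ν + 1)) / (1 - p ^ (ν + k + 1)) := by
  have hν : 0 < ν := by linarith
  have a1 := aux_pos p (μ + k + 1) h0 h1 (by positivity)
  have a2 := aux_pos p (ν + k + 1) h0 h1 (by positivity)
  have hle : p ^ (ν + 1) ≤ p ^ (μ + 1) :=
    Real.rpow_le_rpow_of_exponent_ge h0 h1.le (by linarith)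
  have e : ∀ t : ℝ, p ^ (t + k + 1) = p ^ (t + 1) * p ^ k := fun t => by
    rw [show t + k + 1 = (t + 1) + k by ring, Real.rpow_add h0, Real.rpow_natCast]
  rw [div_le_div_iff₀ a1 a2, e, e]
  have : p ^ k ≤ 1 := pow_le_one₀ h0.le h1.le
  nlinarith [mul_nonneg (sub_nonneg.2 hle) (sub_nonneg.2 this)]

lemma f_anti (p μ : ℝ) (h0 : 0 < p) (h1 : p < 1) (hμ : 0 < μ) :
    Antitone (fun k : ℕ => (1 - p ^ (μ + 1)) / (1 - p ^ (μ + k + 1))) := by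
  intro a b hab
  have a0 := aux_pos p (μ + 1) h0 h1 (by positivity)
  have a1 := aux_pos p (μ + a + 1) h0 h1 (by positivity)
  have hc : (a : ℝ) ≤ b := by exact_mod_cast hab
  have hle : p ^ (μ + b + 1) ≤ p ^ (μ + a + 1) :=
    Real.rpow_le_rpow_of_exponent_ge h0 h1.le (by linarith)
  exact div_le_div_of_nonneg_left a0.le a1 (by linarith)

/-- coefficients independent of ν -/
noncomputable def cc (q : ℝ) (n : ℕ) : ℝ :=
  (if Even n then (1 + q) ^ (n / 2) else (1 + q) ^ n) * qGamma (q ^ 2) ((n / 2 : ℕ) + 1)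

lemma cc_pos (q : ℝ) (n : ℕ) (h0 : 0 < q) (h1 : q < 1) : 0 < cc q n := by
  unfold cc
  have := qGamma_pos (q ^ 2) ((n / 2 : ℕ) + 1) (by positivity) (by nlinarith) (by positivity)
  split_ifs <;> positivity

lemma qDunklB_eq (q ν : ℝ) (n : ℕ) : qDunklB q n ν = cc q n * gg (q ^ 2) ((n + 1) / 2) ν := by
  unfold qDunklB cc gg
  split_ifs with h
  · rw [show (n + 1) / 2 = n / 2 by obtain ⟨k, rfl⟩ := h; omega]; ring
  · rw [show (n + 1) / 2 = n / 2 + 1 by have := Nat.not_even_iff.1 h; omega]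
    rw [Nat.cast_succ, show ν + ((n / 2 : ℕ) + 1 : ℝ) + 1 = ν + (n / 2 : ℕ) + 2 by ring]; ring

lemma cheb_fin (u f r : ℕ → ℝ) (hu : ∀ n, 0 ≤ u n) (hf : Antitone f) (hr : Antitone r) (N : ℕ) :
    (∑ i ∈ Finset.range N, u i * f i) * (∑ i ∈ Finset.range N, u i * r i) ≤
    (∑ i ∈ Finset.range N, u i * f i * r i) * (∑ i ∈ Finset.range N, u i) := by
  have h : 0 ≤ ∑ i ∈ Finset.range N, ∑ j ∈ Finset.range N,
      u i * u j * ((f i - f j) * (r i - r j)) := by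
    refine Finset.sum_nonneg fun i _ => Finset.sum_nonneg fun j _ =>
      mul_nonneg (mul_nonneg (hu i) (hu j)) ?_
    rcases le_total i j with hij | hij
    · exact mul_nonneg (sub_nonneg.2 (hf hij)) (sub_nonneg.2 (hr hij))
    · exact mul_nonneg_of_nonpos_of_nonpos (sub_nonpos.2 (hf hij)) (sub_nonpos.2 (hr hij))
  have e : ∑ i ∈ Finset.range N, ∑ j ∈ Finset.range N,
      u i * u j * ((f i - f j) * (r i - r j)) =
      ∑ i ∈ Finset.range N, ∑ j ∈ Finset.range N,
        ((u i * f i * r i) * u j + u i * (u j * f j * r j) - (u i * f i) * (u j * r j)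
          - (u i * r i) * (u j * f j)) :=
    Finset.sum_congr rfl fun i _ => Finset.sum_congr rfl fun j _ => by ring
  rw [e] at h
  simp only [Finset.sum_sub_distrib, Finset.sum_add_distrib, ← Finset.sum_mul_sum] at h
  nlinarith

lemma cheb (u f r : ℕ → ℝ) (hu : ∀ n, 0 ≤ u n) (hf : Antitone f) (hr : Antitone r)
    (s1 : Summable u) (s2 : Summable fun n => u n * f n) (s3 : Summable fun n => u n * r n)
    (s4 : Summable fun n => u n * f n * r n) :
    (∑' i, u i * f i) * (∑' i, u i * r i) ≤ (∑' i, u i * f i * r i) * (∑' i, u i) :=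
  le_of_tendsto_of_tendsto'
    (s2.hasSum.tendsto_sum_nat.mul s3.hasSum.tendsto_sum_nat)
    (s4.hasSum.tendsto_sum_nat.mul s1.hasSum.tendsto_sum_nat)
    (fun N => cheb_fin u f r hu hf hr N)

/-- the function `ν ↦ E_{ν+1}(λx;q²)/E_ν(λx;q²)` is increasing on `(0,∞)`. -/
theorem qDunklE_ratio_mono (q x lam : ℝ) (hq : q ∈ Set.Ioo (0 : ℝ) 1)
    (hx : x ∈ Set.Ico (0 : ℝ) (1 / (1 - q))) (hlam : lam ∈ Set.Ico (0 : ℝ) (1 / (1 - q))) :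
    ∀ μ ν : ℝ, 0 < μ → μ ≤ ν →
      qDunklE q (μ + 1) (lam * x) / qDunklE q μ (lam * x) ≤
        qDunklE q (ν + 1) (lam * x) / qDunklE q ν (lam * x) := by
  intro μ ν hμ hμν
  obtain ⟨h0, h1⟩ := hq
  have hν : 0 < ν := by linarith
  have hz : 0 ≤ lam * x := mul_nonneg hlam.1 hx.1
  generalize lam * x = z at hz
  set p := q ^ 2 with hp
  have p0 : 0 < p := by positivity
  have p1 : p < 1 := by rw [hp]; nlinarith
  have hB : ∀ t : ℝ, 0 < t → ∀ n, 0 < qDunklB q n t := fun t ht n => by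
    rw [qDunklB_eq]; exact mul_pos (cc_pos q n h0 h1) (gg_pos p t _ p0 p1 ht)
  have hw : ∀ t : ℝ, 0 < t → ∀ n, 0 ≤ z ^ n / qDunklB q n t := fun t ht n =>
    div_nonneg (pow_nonneg hz n) (hB t ht n).le
  by_cases hs : Summable (fun n => z ^ n / qDunklB q n μ)
  swap
  · have : qDunklE q μ z = 0 := tsum_eq_zero_of_not_summable hs
    rw [this, div_zero]
    exact div_nonneg (tsum_nonneg (hw _ (by linarith))) (tsum_nonneg (hw _ hν))
  let m : ℕ → ℕ := fun n => (n + 1) / 2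
  have hm : Monotone m := fun a b h => Nat.div_le_div_right (by omega)
  let f : ℝ → ℕ → ℝ := fun t n => (1 - p ^ (t + 1)) / (1 - p ^ (t + (m n : ℕ) + 1))
  let r : ℕ → ℝ := fun n => gg p (m n) μ / gg p (m n) ν
  have hf : Antitone (f μ) := (f_anti p μ p0 p1 hμ).comp_monotone hm
  have hr : Antitone r := (gg_ratio_anti p μ ν p0 p1 hμ hμν).comp_monotone hm
  have r0 : ∀ n, 0 ≤ r n := fun n =>
    (div_pos (gg_pos p μ _ p0 p1 hμ) (gg_pos p ν _ p0 p1 hν)).le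
  have r1 : ∀ n, r n ≤ 1 := fun n => by
    refine (hr (Nat.zero_le n)).trans (le_of_eq ?_)
    simp [r, m, gg_zero p _ p0 p1 hμ, gg_zero p _ p0 p1 hν]
  have f0 : ∀ t, 0 < t → ∀ n, 0 ≤ f t n := fun t ht n =>
    div_nonneg (aux_pos p _ p0 p1 (by positivity)).le (aux_pos p _ p0 p1 (by positivity)).le
  have f1 : ∀ t, 0 < t → ∀ n, f t n ≤ 1 := fun t ht n => by
    refine (((f_anti p t p0 p1 ht).comp_monotone hm) (Nat.zero_le n)).trans (le_of_eq ?_)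
    simp [m, (aux_pos p (t + 1) p0 p1 (by positivity)).ne']
  have eshift : ∀ t, 0 < t → ∀ n, z ^ n / qDunklB q n (t + 1) = z ^ n / qDunklB q n t * f t n := by
    intro t ht n
    rw [qDunklB_eq, qDunklB_eq, ← hp, gg_shift p t _ p0 p1 ht]
    have := (cc_pos q n h0 h1).ne'
    have := (gg_pos p t (m n) p0 p1 ht).ne'
    have := (aux_pos p (t + 1) p0 p1 (by positivity)).ne'
    have := (aux_pos p (t + (m n : ℕ) + 1) p0 p1 (by positivity)).ne'
    simp only [f, m] at *
    field_simp
  have er : ∀ n, z ^ n / qDunklB q n ν = z ^ n / qDunklB q n μ * r n := by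
    intro n
    rw [qDunklB_eq, qDunklB_eq, ← hp]
    have := (cc_pos q n h0 h1).ne'
    have := (gg_pos p μ (m n) p0 p1 hμ).ne'
    have := (gg_pos p ν (m n) p0 p1 hν).ne'
    simp only [r, m] at *
    field_simp
  have sf : ∀ (u g : ℕ → ℝ), (∀ n, 0 ≤ u n) → (∀ n, 0 ≤ g n) → (∀ n, g n ≤ 1) → Summable u →
      Summable (fun n => u n * g n) := fun u g hu hg hg1 hsu =>
    Summable.of_nonneg_of_le (fun n => mul_nonneg (hu n) (hg n))
      (fun n => mul_le_of_le_one_right (hu n) (hg1 n)) hsu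
  have hu := hw μ hμ
  have s2 := sf _ (f μ) hu (f0 μ hμ) (f1 μ hμ) hs
  have s3 := sf _ r hu r0 r1 hs
  have s4 := sf _ r (fun n => mul_nonneg (hu n) (f0 μ hμ n)) r0 r1 s2
  have hsν : Summable (fun n => z ^ n / qDunklB q n ν) := s3.congr fun n => (er n).symm
  have s5 := sf _ (f ν) (hw ν hν) (f0 ν hν) (f1 ν hν) hsν
  have pos : ∀ t, 0 < t → Summable (fun n => z ^ n / qDunklB q n t) → 0 < qDunklE q t z :=
    fun t ht hst => hst.tsum_pos (hw t ht) 0 (by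
      rw [pow_zero]; exact div_pos one_pos (hB t ht 0))
  rw [div_le_div_iff₀ (pos μ hμ hs) (pos ν hν hsν)]
  have key := cheb _ (f μ) r hu hf hr hs s2 s3 s4
  have E1 : qDunklE q (μ + 1) z = ∑' n, z ^ n / qDunklB q n μ * f μ n :=
    tsum_congr (eshift μ hμ)
  have E2 : qDunklE q ν z = ∑' n, z ^ n / qDunklB q n μ * r n := tsum_congr er
  have E3 : qDunklE q (ν + 1) z = ∑' n, z ^ n / qDunklB q n ν * f ν n :=
    tsum_congr (eshift ν hν)
  rw [E1, E2]
  refine key.trans (mul_le_mul_of_nonneg_right ?_ (pos μ hμ hs).le)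
  rw [E3]
  refine s4.tsum_le_tsum (fun n => ?_) s5
  rw [er n, mul_right_comm]
  exact mul_le_mul_of_nonneg_left (f_mono p μ ν (m n) p0 p1 hμ hμν) (mul_nonneg (hu n) (r0 n))
end

section
/- For all λ ≥ 0, x ≥ 0 and ν > 0, E_{ν+1}(λ,x) ≤ E_ν(λ,x). -/
open Real

/-- `b_n(ν)` from the series expansion of the Dunkl kernel:
`b_{2n}(ν) = 2^{2n} n! Γ(n+ν+1)/Γ(ν+1)` and `b_{2n+1}(ν) = 2(ν+1) b_{2n}(ν+1)`. -/
noncomputable def dunklB (n : ℕ) (ν : ℝ) : ℝ :=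
  if Even n then
    2 ^ n * (Nat.factorial (n / 2)) * Real.Gamma ((n / 2 : ℕ) + ν + 1) / Real.Gamma (ν + 1)
  else
    2 * (ν + 1) *
      (2 ^ (n - 1) * (Nat.factorial (n / 2)) * Real.Gamma ((n / 2 : ℕ) + (ν + 1) + 1) /
        Real.Gamma ((ν + 1) + 1))

/-- The Dunkl kernel `E_ν(λ, x) = Σ_{n=0}^∞ (λ x)^n / b_n(ν)`. -/
noncomputable def dunklE (ν lam x : ℝ) : ℝ :=
  ∑' n : ℕ, (lam * x) ^ n / dunklB n ν

/-- The normalized Dunkl kernel `Ẽ_ν(λ,x) = ∫_{-1}^1 e^{λxt}(1-t²)^{ν-1}(1+t) dt`. -/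
noncomputable def dunklEt (ν lam x : ℝ) : ℝ :=
  ∫ t in (-1 : ℝ)..1, Real.exp (lam * x * t) * (1 - t ^ 2) ^ (ν - 1) * (1 + t)

lemma dunklB_zero' (ν : ℝ) (hν : 0 < ν) : dunklB 0 ν = 1 := by
  have h := (Real.Gamma_pos_of_pos (show 0 < ν + 1 by linarith)).ne'
  simp [dunklB, h]

lemma dunklB_odd' (m : ℕ) (ν : ℝ) (hν : 0 < ν) :
    dunklB (2 * m + 1) ν = dunklB (2 * m) ν * (2 * (m + ν + 1)) := by
  have h := (Real.Gamma_pos_of_pos (show 0 < ν + 1 by linarith)).ne'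
  have h1 : (0 : ℝ) ≤ m := Nat.cast_nonneg m
  have e1 : Real.Gamma (ν + 1 + 1) = (ν + 1) * Real.Gamma (ν + 1) :=
    Real.Gamma_add_one (by linarith)
  have e2 : Real.Gamma ((m : ℝ) + (ν + 1) + 1) = (m + ν + 1) * Real.Gamma (m + ν + 1) := by
    rw [← add_assoc]
    exact Real.Gamma_add_one (by linarith)
  have h2 : (2 * m + 1) / 2 = m := by omega
  have h3 : ¬ Even (2 * m + 1) := by simp
  have h4 : ν + 1 ≠ 0 := by linarith
  have h5 : 2 * m / 2 = m := by omega
  unfold dunklB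
  rw [if_neg h3, if_pos (even_two_mul m), h2, h5, Nat.add_sub_cancel, e1, e2]
  field_simp

lemma dunklB_even' (m : ℕ) (ν : ℝ) (hν : 0 < ν) :
    dunklB (2 * m + 2) ν = dunklB (2 * m + 1) ν * (2 * (m + 1)) := by
  have h := (Real.Gamma_pos_of_pos (show 0 < ν + 1 by linarith)).ne'
  have e1 : Real.Gamma (ν + 1 + 1) = (ν + 1) * Real.Gamma (ν + 1) :=
    Real.Gamma_add_one (by linarith)
  have h2 : (2 * m + 1) / 2 = m := by omega
  have h3 : ¬ Even (2 * m + 1) := by simp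
  have h4 : ν + 1 ≠ 0 := by linarith
  have h5 : (2 * m + 2) / 2 = m + 1 := by omega
  have h6 : Even (2 * m + 2) := ⟨m + 1, by ring⟩
  have e2 : ((m + 1 : ℕ) : ℝ) + ν + 1 = (m : ℝ) + (ν + 1) + 1 := by push_cast; ring
  unfold dunklB
  rw [if_neg h3, if_pos h6, h2, h5, Nat.add_sub_cancel, e1, e2, Nat.factorial_succ]
  push_cast
  field_simp
  ring

lemma dunklB_bounds' (ν : ℝ) (hν : 0 < ν) (n : ℕ) :
    (n.factorial : ℝ) ≤ dunklB n ν ∧ dunklB n ν ≤ dunklB n (ν + 1) := by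
  have hν' : 0 < ν + 1 := by linarith
  induction n with
  | zero => simp [dunklB_zero' ν hν, dunklB_zero' (ν + 1) hν']
  | succ n ih =>
    obtain ⟨ih1, ih2⟩ := ih
    have hf : (0 : ℝ) ≤ n.factorial := Nat.cast_nonneg _
    have hb : 0 ≤ dunklB n ν := hf.trans ih1
    rw [Nat.factorial_succ, mul_comm, Nat.cast_mul]
    rcases Nat.even_or_odd' n with ⟨m, rfl | rfl⟩
    · have hm : (0 : ℝ) ≤ m := Nat.cast_nonneg m
      rw [dunklB_odd' m ν hν, dunklB_odd' m (ν + 1) hν']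
      constructor
      · apply mul_le_mul ih1 _ (Nat.cast_nonneg _) hb
        push_cast; linarith
      · apply mul_le_mul ih2 _ _ (hb.trans ih2) <;> linarith
    · have hm : (0 : ℝ) ≤ m := Nat.cast_nonneg m
      rw [show 2 * m + 1 + 1 = 2 * m + 2 from rfl, dunklB_even' m ν hν, dunklB_even' m (ν + 1) hν']
      constructor
      · apply mul_le_mul ih1 _ (Nat.cast_nonneg _) hb
        push_cast; linarith
      · apply mul_le_mul_of_nonneg_right ih2; linarith

lemma dunkl_summable' (ν y : ℝ) (hy : 0 ≤ y) (hν : 0 < ν) :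
    Summable (fun n : ℕ => y ^ n / dunklB n ν) := by
  refine Summable.of_nonneg_of_le (fun n => ?_) (fun n => ?_) (Real.summable_pow_div_factorial y)
  · exact div_nonneg (pow_nonneg hy n) ((Nat.cast_nonneg _).trans (dunklB_bounds' ν hν n).1)
  · exact div_le_div_of_nonneg_left (pow_nonneg hy n) (by positivity) (dunklB_bounds' ν hν n).1

/-- `E_{ν+1}(λ,x) ≤ E_ν(λ,x)` for `λ, x ≥ 0` and `ν > 0`. -/
theorem dunklE_antitone (lam x ν : ℝ) (hlam : 0 ≤ lam) (hx : 0 ≤ x) (hν : 0 < ν) :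
    dunklE (ν + 1) lam x ≤ dunklE ν lam x := by
  have hy : 0 ≤ lam * x := mul_nonneg hlam hx
  refine Summable.tsum_le_tsum (fun n => ?_) (dunkl_summable' (ν + 1) _ hy (by linarith))
    (dunkl_summable' ν _ hy hν)
  have hb := dunklB_bounds' ν hν n
  have hf : (0 : ℝ) < n.factorial := by positivity
  exact div_le_div_of_nonneg_left (pow_nonneg hy n) (hf.trans_le hb.1) hb.2
end
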